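/- arXiv:1211.1056 — 4 statements merged into one kernel-verified Lean document; each statement's English description precedes it below -/
import Mathlib

section
/- Let d ≥ 5 be an integer, let 0 < a ≤ b be reals, and let s > 0. Then ∫_a^b s·ν_{τ,d}(s) dτ = (s/(1−2/d))·Γ_{d/2−1}([sd/(2b), sd/(2a)]) and ∫_a^b τ·ν_{τ,d}(s) dτ = (s/(1−6/d+8/d²))·Γ_{d/2−2}([sd/(2b), sd/(2a)]). -/
open MeasureTheory Real

/-- The density of the χ²-distribution with `d` degrees of freedom rescaled to have mean `τ`,
evaluated at `s`. -/
noncomputable def nu (d : ℕ) (τ s : ℝ) : ℝ :=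
  d * (s * d / τ) ^ ((d : ℝ) / 2 - 1) * Real.exp (-(s * d) / (2 * τ)) /
    (τ * (2 : ℝ) ^ ((d : ℝ) / 2) * Real.Gamma ((d : ℝ) / 2))

/-- The density of the Gamma distribution with shape parameter `a` (and rate 1). -/
noncomputable def gammaDens (a x : ℝ) : ℝ := x ^ (a - 1) * Real.exp (-x) / Real.Gamma a

/-- The change of variables `x = c / τ`. -/
lemma setIntegral_Icc_div_eq_intervalIntegral {a b c : ℝ} (ha : 0 < a) (hab : a ≤ b)
    (hc : 0 < c) (g : ℝ → ℝ) :
    ∫ x in Set.Icc (c / b) (c / a), g x = ∫ τ in a..b, c / τ ^ 2 * g (c / τ) := by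
  have hpos : ∀ x ∈ Set.uIcc a b, 0 < x := fun x hx =>
    ha.trans_le (Set.uIcc_of_le hab ▸ hx).1
  have key := intervalIntegral.integral_comp_mul_deriv_of_deriv_nonpos (a := a) (b := b)
    (f := fun τ => c / τ) (f' := fun τ => -(c / τ ^ 2)) (g := g)
    (continuousOn_const.div continuousOn_id fun x hx => (hpos x hx).ne')
    (fun x hx => by
      have hx0 : x ≠ 0 := (hpos x (Set.Ioo_subset_Icc_self hx)).ne'
      exact ((hasDerivAt_const x c).div (hasDerivAt_id x) hx0).congr_deriv (by simp [neg_div]))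
    (fun x _ => neg_nonpos.mpr (by positivity))
  rw [integral_Icc_eq_integral_Ioc,
    ← intervalIntegral.integral_of_le (div_le_div_of_nonneg_left hc.le ha hab),
    intervalIntegral.integral_symm, ← key, ← intervalIntegral.integral_neg]
  exact intervalIntegral.integral_congr fun x _ => by simp [mul_comm]

lemma nu_eq {d : ℕ} (hd : 0 < d) {τ s : ℝ} (hτ : 0 < τ) (hs : 0 < s) :
    nu d τ s = d / 2 * (s * d / 2 / τ) ^ ((d : ℝ) / 2 - 1) * Real.exp (-(s * d / 2 / τ)) /
      (τ * Real.Gamma ((d : ℝ) / 2)) := by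
  have hd' : (0 : ℝ) < d := Nat.cast_pos.mpr hd
  have hx : s * d / τ = 2 * (s * d / 2 / τ) := by ring
  have he : -(s * d) / (2 * τ) = -(s * d / 2 / τ) := by field_simp
  have hG := Real.Gamma_pos_of_pos (half_pos hd')
  have h2 : (0 : ℝ) < 2 ^ ((d : ℝ) / 2) := by positivity
  rw [nu, he, hx, Real.mul_rpow two_pos.le (by positivity), Real.rpow_sub_one two_ne_zero]
  field_simp

lemma mul_nu_eq_gammaDens {d : ℕ} (hd : 3 ≤ d) {τ s : ℝ} (hτ : 0 < τ) (hs : 0 < s) :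
    s * nu d τ s = s / (1 - 2 / d) *
      (s * d / 2 / τ ^ 2 * gammaDens ((d : ℝ) / 2 - 1) (s * d / 2 / τ)) := by
  have hd' : (3 : ℝ) ≤ d := by exact_mod_cast hd
  have hG : Real.Gamma ((d : ℝ) / 2) = ((d : ℝ) / 2 - 1) * Real.Gamma ((d : ℝ) / 2 - 1) := by
    rw [← Real.Gamma_add_one (by linarith), sub_add_cancel]
  have hG0 := Real.Gamma_pos_of_pos (show 0 < (d : ℝ) / 2 - 1 by linarith)
  have hx : 0 < s * d / 2 / τ := by positivity
  have h1 : (d : ℝ) / 2 - 1 ≠ 0 := by linarith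
  have h2 : (1 : ℝ) - 2 / d = ((d : ℝ) / 2 - 1) * 2 / d := by field_simp
  rw [nu_eq (by omega) hτ hs, gammaDens, hG, Real.rpow_sub_one hx.ne' ((d : ℝ) / 2 - 1), h2]
  generalize (s * d / 2 / τ) ^ ((d : ℝ) / 2 - 1) = p
  generalize Real.exp (-(s * d / 2 / τ)) = e
  generalize (d : ℝ) / 2 - 1 = k at *
  field_simp

lemma self_mul_nu_eq_gammaDens {d : ℕ} (hd : 5 ≤ d) {τ s : ℝ} (hτ : 0 < τ) (hs : 0 < s) :
    τ * nu d τ s = s / (1 - 6 / d + 8 / (d : ℝ) ^ 2) *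
      (s * d / 2 / τ ^ 2 * gammaDens ((d : ℝ) / 2 - 2) (s * d / 2 / τ)) := by
  have hd' : (5 : ℝ) ≤ d := by exact_mod_cast hd
  have hG : Real.Gamma ((d : ℝ) / 2) =
      ((d : ℝ) / 2 - 1) * (((d : ℝ) / 2 - 2) * Real.Gamma ((d : ℝ) / 2 - 2)) := by
    rw [← Real.Gamma_add_one (by linarith), show (d : ℝ) / 2 - 2 + 1 = d / 2 - 1 by ring,
      ← Real.Gamma_add_one (by linarith), sub_add_cancel]
  have hG0 := Real.Gamma_pos_of_pos (show 0 < (d : ℝ) / 2 - 2 by linarith)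
  have hx : 0 < s * d / 2 / τ := by positivity
  have h1 : (d : ℝ) / 2 - 1 ≠ 0 := by linarith
  have h2 : (d : ℝ) / 2 - 2 ≠ 0 := by linarith
  have h3 : (1 : ℝ) - 6 / d + 8 / (d : ℝ) ^ 2 =
      ((d : ℝ) / 2 - 1) * ((d : ℝ) / 2 - 2) * 4 / (d : ℝ) ^ 2 := by
    field_simp
    ring
  have hp : (s * d / 2 / τ) ^ ((d : ℝ) / 2 - 2 - 1) =
      (s * d / 2 / τ) ^ ((d : ℝ) / 2 - 1) / (s * d / 2 / τ) ^ 2 := by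
    rw [← Real.rpow_sub_natCast hx.ne']
    congr 1
    push_cast
    ring
  rw [nu_eq (by omega) hτ hs, gammaDens, hG, hp, h3]
  generalize (s * d / 2 / τ) ^ ((d : ℝ) / 2 - 1) = p
  generalize Real.exp (-(s * d / 2 / τ)) = e
  generalize (d : ℝ) / 2 - 1 = k at *
  generalize (d : ℝ) / 2 - 2 = l at *
  field_simp
  ring

theorem stmt0 (d : ℕ) (hd : 5 ≤ d) (a b s : ℝ) (ha : 0 < a) (hab : a ≤ b) (hs : 0 < s) :
    ((∫ τ in a..b, s * nu d τ s) =
      s / (1 - 2 / d) *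
        ∫ x in Set.Icc (s * d / (2 * b)) (s * d / (2 * a)), gammaDens ((d : ℝ) / 2 - 1) x) ∧
    ((∫ τ in a..b, τ * nu d τ s) =
      s / (1 - 6 / d + 8 / (d : ℝ) ^ 2) *
        ∫ x in Set.Icc (s * d / (2 * b)) (s * d / (2 * a)), gammaDens ((d : ℝ) / 2 - 2) x) := by
  have hc : 0 < s * d / 2 := by
    have : 0 < d := by omega
    positivity
  have hpos : ∀ τ ∈ Set.uIcc a b, 0 < τ := fun τ hτ =>
    ha.trans_le (Set.uIcc_of_le hab ▸ hτ).1
  simp only [← div_div (s * d) 2]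
  rw [setIntegral_Icc_div_eq_intervalIntegral ha hab hc,
    setIntegral_Icc_div_eq_intervalIntegral ha hab hc,
    ← intervalIntegral.integral_const_mul, ← intervalIntegral.integral_const_mul]
  exact ⟨intervalIntegral.integral_congr fun τ hτ =>
      mul_nu_eq_gammaDens (by omega) (hpos τ hτ) hs,
    intervalIntegral.integral_congr fun τ hτ => self_mul_nu_eq_gammaDens hd (hpos τ hτ) hs⟩
end

section
/- Let d ≥ 20 be an integer and let B > 4. Then for every s with 0 < s ≤ Bd/2 one has Δ(s) < 0, and moreover for every s with d ≤ s ≤ 2d one has Δ(s) < −s/(3d). -/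
open MeasureTheory Real

/-- `Δ(s) = ∫_d^{Bd} (s − τ) ν_{τ,d}(s) dτ`. -/
noncomputable def Delta (d : ℕ) (B s : ℝ) : ℝ :=
  ∫ τ in (d : ℝ)..(B * d), (s - τ) * nu d τ s

/-- The unnormalised density `u ↦ u ^ p * exp (-u)` of the Gamma distribution. -/
noncomputable def gammaKernel (p u : ℝ) : ℝ := u ^ p * Real.exp (-u)

theorem gammaKernel_pos (p : ℝ) {u : ℝ} (hu : 0 < u) : 0 < gammaKernel p u :=
  mul_pos (Real.rpow_pos_of_pos hu p) (Real.exp_pos _)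

theorem gammaKernel_nonneg (p : ℝ) {u : ℝ} (hu : 0 ≤ u) : 0 ≤ gammaKernel p u :=
  mul_nonneg (Real.rpow_nonneg hu p) (Real.exp_pos _).le

theorem continuous_gammaKernel {p : ℝ} (hp : 0 ≤ p) : Continuous (gammaKernel p) :=
  (Real.continuous_rpow_const hp).mul (Real.continuous_exp.comp continuous_neg)

theorem gammaKernel_add_one (p : ℝ) {u : ℝ} (hu : 0 < u) :
    gammaKernel (p + 1) u = u * gammaKernel p u := by
  unfold gammaKernel
  rw [Real.rpow_add_one hu.ne']
  ring

theorem hasDerivAt_gammaKernel_add_one (p : ℝ) {u : ℝ} (hu : 0 < u) :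
    HasDerivAt (gammaKernel (p + 1)) ((p + 1 - u) * gammaKernel p u) u := by
  have h₁ := Real.hasDerivAt_rpow_const (x := u) (p := p + 1) (Or.inl hu.ne')
  have h₂ := (Real.hasDerivAt_exp (-u)).comp u (hasDerivAt_neg u)
  refine (h₁.mul h₂).congr_deriv ?_
  simp only [gammaKernel, Function.comp_apply, add_sub_cancel_right]
  rw [Real.rpow_add_one hu.ne']
  ring

theorem integral_add_three_sub_mul_gammaKernel {p x y : ℝ} (hp : 0 ≤ p) (hy : 0 < y)
    (hyx : y ≤ x) :
    ∫ u in y..x, (p + 3 - u) * gammaKernel p u =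
      2 * (∫ u in y..x, gammaKernel p u) + gammaKernel (p + 1) x - gammaKernel (p + 1) y := by
  have hc := continuous_gammaKernel hp
  have hc' : Continuous fun u => (p + 1 - u) * gammaKernel p u := by fun_prop
  have h := intervalIntegral.integral_eq_sub_of_hasDerivAt (a := y) (b := x)
    (f := gammaKernel (p + 1)) (f' := fun u => (p + 1 - u) * gammaKernel p u)
    (fun u hu => hasDerivAt_gammaKernel_add_one p
      (hy.trans_le (by rw [Set.uIcc_of_le hyx] at hu; exact hu.1)))
    (hc'.intervalIntegrable _ _)
  rw [add_sub_assoc, ← h, ← intervalIntegral.integral_const_mul,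
    ← intervalIntegral.integral_add ((hc.const_mul 2).intervalIntegrable _ _)
      (hc'.intervalIntegrable _ _)]
  congr 1
  ext u
  ring

theorem gammaKernel_le_exp_mul {p u v : ℝ} (hp : 0 ≤ p) (hu : 0 < u) (huv : u ≤ v) :
    gammaKernel p u ≤ Real.exp ((v - u) * (1 - 2 * p / (v + u))) * gammaKernel p v := by
  have hv : 0 < v := hu.trans_le huv
  have hlog := Real.le_log_one_add_of_nonneg (x := v / u - 1)
    (by rw [sub_nonneg, le_div_iff₀ hu]; linarith)
  have hle : 2 * (v - u) / (v + u) ≤ Real.log v - Real.log u := by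
    rw [← Real.log_div hv.ne' hu.ne']
    convert hlog using 1
    · have : v / u - 1 + 2 = (v + u) / u := by field_simp; ring
      rw [this]
      field_simp
    · ring_nf
  unfold gammaKernel
  rw [Real.rpow_def_of_pos hu, Real.rpow_def_of_pos hv, ← Real.exp_add, ← Real.exp_add,
    ← Real.exp_add, Real.exp_le_exp]
  have := mul_le_mul_of_nonneg_left hle hp
  have e : p * (2 * (v - u) / (v + u)) = (v - u) * (2 * p / (v + u)) := by ring
  nlinarith

theorem gammaKernel_add_one_le_integral {p y : ℝ} (hp : 7 ≤ p) (hy : 0 < y)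
    (hyp : y ≤ (p + 3) / 2) :
    gammaKernel (p + 1) y ≤ 2 * ∫ u in y..(3 / 2 * y), gammaKernel p u := by
  have hc := continuous_gammaKernel (p := p) (by linarith)
  have h : ∫ _ in y..(3 / 2 * y), gammaKernel p y ≤ ∫ u in y..(3 / 2 * y), gammaKernel p u := by
    refine intervalIntegral.integral_mono_on (by linarith) (by simp)
      (hc.intervalIntegrable _ _) fun v hv => ?_
    refine (gammaKernel_le_exp_mul (by linarith) hy hv.1).trans
      (mul_le_of_le_one_left (gammaKernel_nonneg p (by linarith [hv.1])) ?_)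
    rw [Real.exp_le_one_iff]
    refine mul_nonpos_of_nonneg_of_nonpos (by linarith [hv.1]) ?_
    rw [sub_nonpos, le_div_iff₀ (by linarith [hv.1])]
    linarith [hv.2]
  rw [intervalIntegral.integral_const, smul_eq_mul] at h
  rw [gammaKernel_add_one p hy]
  linarith

theorem integral_add_three_sub_mul_gammaKernel_lower {p x y b : ℝ} (hp : 7 ≤ p) (hy : 0 < y)
    (hyp : y ≤ (p + 3) / 2) (hyb : 3 / 2 * y ≤ b) (hbx : b ≤ x) :
    2 * (∫ u in b..x, gammaKernel p u) + gammaKernel (p + 1) x ≤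
      ∫ u in y..x, (p + 3 - u) * gammaKernel p u := by
  have hc := continuous_gammaKernel (p := p) (by linarith)
  rw [integral_add_three_sub_mul_gammaKernel (by linarith) hy (by linarith),
    ← intervalIntegral.integral_add_adjacent_intervals (hc.intervalIntegrable y (3 / 2 * y))
      (hc.intervalIntegrable _ _),
    ← intervalIntegral.integral_add_adjacent_intervals (hc.intervalIntegrable (3 / 2 * y) b)
      (hc.intervalIntegrable _ _)]
  have h₁ := gammaKernel_add_one_le_integral hp hy hyp
  have h₂ : 0 ≤ ∫ u in (3 / 2 * y)..b, gammaKernel p u :=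
    intervalIntegral.integral_nonneg hyb fun u hu => gammaKernel_nonneg p (by linarith [hu.1])
  linarith

theorem gammaKernel_le_three_mul {p u v : ℝ} (hp : 7 ≤ p) (hu : 0 < u) (huv : u ≤ v)
    (hv : v ≤ p + 3) : gammaKernel p u ≤ 3 * gammaKernel p v := by
  refine (gammaKernel_le_exp_mul (by linarith) hu huv).trans
    (mul_le_mul_of_nonneg_right ?_ (gammaKernel_nonneg p (by linarith)))
  refine le_trans (Real.exp_le_exp.2 ?_) (Real.exp_one_lt_d9.le.trans (by norm_num))
  have hs : 0 < v + u := by linarith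
  rw [one_sub_div hs.ne', ← mul_div_assoc, div_le_one hs]
  rcases le_total (v + u) (2 * p) with h | h
  · nlinarith [mul_nonneg (sub_nonneg.2 huv) (sub_nonneg.2 h)]
  · nlinarith [sq_nonneg (v - u - (v + u - 2 * p))]

theorem integral_gammaKernel_zero_le {p : ℝ} (hp : 7 ≤ p) :
    ∫ u in (0 : ℝ)..(3 / 4 * (p + 3)), gammaKernel p u ≤
      9 * ∫ u in (3 / 4 * (p + 3))..(p + 3), gammaKernel p u := by
  have hc := continuous_gammaKernel (p := p) (by linarith)
  set b := 3 / 4 * (p + 3) with hb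
  have h₁ : ∀ v ∈ Set.Icc b (p + 3),
      ∫ u in (0 : ℝ)..b, gammaKernel p u ≤ b * 3 * gammaKernel p v := by
    intro v hv
    have h : ∫ u in (0 : ℝ)..b, gammaKernel p u ≤ ∫ _ in (0 : ℝ)..b, 3 * gammaKernel p v :=
      intervalIntegral.integral_mono_on_of_le_Ioo (by linarith) (hc.intervalIntegrable _ _)
        (by simp) fun u hu => gammaKernel_le_three_mul hp hu.1 (hu.2.le.trans hv.1) hv.2
    rw [intervalIntegral.integral_const, smul_eq_mul] at h
    linarith
  have h₂ := intervalIntegral.integral_mono_on (μ := volume) (by linarith : b ≤ p + 3)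
    (by simp) ((hc.const_mul (b * 3)).intervalIntegrable _ _) h₁
  rw [intervalIntegral.integral_const, smul_eq_mul, intervalIntegral.integral_const_mul] at h₂
  have hb0 : 0 < b := by linarith
  have e : p + 3 - b = b / 3 := by linarith
  rw [e] at h₂
  refine le_of_mul_le_mul_left ?_ (by linarith : 0 < b / 3)
  linarith

theorem Gamma_add_one_le_integral_gammaKernel {p x : ℝ} (hp : 0 ≤ p) (hx : p + 3 ≤ x) :
    Real.Gamma (p + 1) ≤ (∫ u in (0 : ℝ)..x, gammaKernel p u) + gammaKernel (p + 1) x / 2 := by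
  have hc := continuous_gammaKernel hp
  have hk : (fun u : ℝ => Real.exp (-u) * u ^ (p + 1 - 1)) = gammaKernel p := by
    ext u
    rw [add_sub_cancel_right, mul_comm, gammaKernel]
  have hi := Real.GammaIntegral_convergent (s := p + 1) (by linarith)
  have hG := Real.Gamma_eq_integral (s := p + 1) (by linarith)
  rw [hk] at hi hG
  rw [hG]
  refine le_of_tendsto (intervalIntegral_tendsto_integral_Ioi 0 hi Filter.tendsto_id) ?_
  filter_upwards [Filter.eventually_ge_atTop x] with R hR
  have h₁ := integral_add_three_sub_mul_gammaKernel hp (by linarith : 0 < x) hR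
  have h₂ : ∫ u in x..R, (p + 3 - u) * gammaKernel p u ≤ ∫ _ in x..R, (0 : ℝ) :=
    intervalIntegral.integral_mono_on hR
      (Continuous.intervalIntegrable (by fun_prop) _ _) (by simp)
      fun u hu => mul_nonpos_of_nonpos_of_nonneg (by linarith [hu.1])
        (gammaKernel_nonneg p (by linarith [hu.1]))
  rw [intervalIntegral.integral_zero, h₁] at h₂
  have h₃ := gammaKernel_nonneg (p + 1) (by linarith : 0 ≤ R)
  rw [id, ← intervalIntegral.integral_add_adjacent_intervals (hc.intervalIntegrable 0 x)
    (hc.intervalIntegrable _ _)]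
  linarith

theorem Gamma_add_one_le_five_mul {p x y : ℝ} (hp : 7 ≤ p) (hy : 0 < y)
    (hyp : y ≤ (p + 3) / 2) (hx : p + 3 ≤ x) :
    Real.Gamma (p + 1) ≤ 5 * ∫ u in y..x, (p + 3 - u) * gammaKernel p u := by
  have hc := continuous_gammaKernel (p := p) (by linarith)
  have h₁ := integral_add_three_sub_mul_gammaKernel_lower (b := 3 / 4 * (p + 3)) (x := x)
    hp hy hyp (by linarith) (by linarith)
  have h₂ := Gamma_add_one_le_integral_gammaKernel (by linarith) hx
  have h₃ := integral_gammaKernel_zero_le hp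
  have h₄ : 0 ≤ ∫ u in (p + 3)..x, gammaKernel p u :=
    intervalIntegral.integral_nonneg hx fun u hu => gammaKernel_nonneg p (by linarith [hu.1])
  have h₅ := gammaKernel_nonneg (p + 1) (by linarith : 0 ≤ x)
  rw [← intervalIntegral.integral_add_adjacent_intervals
    (hc.intervalIntegrable 0 (3 / 4 * (p + 3))) (hc.intervalIntegrable _ _)] at h₂
  have h₆ := intervalIntegral.integral_add_adjacent_intervals (μ := volume)
    (hc.intervalIntegrable (3 / 4 * (p + 3)) (p + 3)) (hc.intervalIntegrable (p + 3) x)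
  linarith

/-- The substitution `u = s d / (2 τ)`. -/
theorem Delta_eq {d : ℕ} (hd : 0 < d) {p B s : ℝ} (hp : 0 ≤ p) (hdp : (d : ℝ) = 2 * (p + 3))
    (hB : 1 ≤ B) (hs : 0 < s) :
    Delta d B s = -(s * (p + 3) / Real.Gamma (p + 3) *
      ∫ u in (s / 2 / B)..(s / 2), (p + 3 - u) * gammaKernel p u) := by
  have hd0 : (0 : ℝ) < d := by exact_mod_cast hd
  have hΓ : 0 < Real.Gamma (p + 3) := Real.Gamma_pos_of_pos (by linarith)
  have hle : (d : ℝ) ≤ B * d := by nlinarith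
  have hpos : ∀ τ ∈ Set.uIcc (d : ℝ) (B * d), 0 < τ := fun τ hτ => by
    rw [Set.uIcc_of_le hle] at hτ
    exact hd0.trans_le hτ.1
  have hc := continuous_gammaKernel hp
  have hsub := intervalIntegral.integral_comp_mul_deriv (a := (d : ℝ)) (b := B * d)
    (f := fun τ => s * (p + 3) / τ) (f' := fun τ => -(s * (p + 3)) / τ ^ 2)
    (g := fun u => (p + 3 - u) * gammaKernel p u)
    (fun τ hτ => by
      simpa [div_eq_mul_inv] using (hasDerivAt_inv (hpos τ hτ).ne').const_mul (s * (p + 3)))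
    (ContinuousOn.div continuousOn_const (by fun_prop) fun τ hτ => (pow_pos (hpos τ hτ) 2).ne')
    (by fun_prop)
  have e₁ : s * (p + 3) / (d : ℝ) = s / 2 := by rw [hdp]; field_simp
  have e₂ : s * (p + 3) / (B * d) = s / 2 / B := by rw [hdp]; field_simp
  simp only [e₁, e₂] at hsub
  rw [intervalIntegral.integral_symm (s / 2), ← hsub, mul_neg, neg_neg,
    ← intervalIntegral.integral_const_mul, Delta]
  refine intervalIntegral.integral_congr fun τ hτ => ?_
  have hτ0 := hpos τ hτ
  have hu : 0 < s * (p + 3) / τ := by positivity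
  have ea : (d : ℝ) / 2 = p + 3 := by linarith
  have eu : s * d / τ = 2 * (s * (p + 3) / τ) := by rw [hdp]; ring
  have ev : -(s * d) / (2 * τ) = -(s * (p + 3) / τ) := by rw [hdp]; field_simp
  have e2 : (2 : ℝ) ^ (p + 3) = 2 * 2 ^ (p + 2) := by
    rw [← Real.rpow_one_add' (by norm_num) (by linarith)]; ring_nf
  have er : (s * (p + 3) / τ) ^ (p + 2) =
      (s * (p + 3) / τ) ^ p * (s * (p + 3) / τ) ^ 2 := by
    exact_mod_cast Real.rpow_add_natCast hu.ne' p 2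
  have h2 : (0 : ℝ) < 2 ^ (p + 2) := by positivity
  simp only [nu, Function.comp_apply, gammaKernel, ea, ev]
  rw [eu, show p + 3 - 1 = p + 2 by ring, Real.mul_rpow (by norm_num) hu.le, e2, er, hdp]
  generalize (s * (p + 3) / τ) ^ p = A
  generalize Real.exp (-(s * (p + 3) / τ)) = E
  field_simp
  ring

theorem stmt1 (d : ℕ) (hd : 20 ≤ d) (B : ℝ) (hB : 4 < B) :
    (∀ s : ℝ, 0 < s → s ≤ B * d / 2 → Delta d B s < 0) ∧
    (∀ s : ℝ, (d : ℝ) ≤ s → s ≤ 2 * d → Delta d B s < -s / (3 * d)) := by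
  have hd' : (20 : ℝ) ≤ d := by exact_mod_cast hd
  obtain ⟨p, hdp⟩ : ∃ p : ℝ, (d : ℝ) = 2 * (p + 3) := ⟨d / 2 - 3, by ring⟩
  have hp : 7 ≤ p := by linarith
  have hB0 : 0 < B := by linarith
  have hΓ : 0 < Real.Gamma (p + 3) := Real.Gamma_pos_of_pos (by linarith)
  refine ⟨fun s hs hsB => ?_, fun s hds hsd => ?_⟩
  · rw [Delta_eq (by omega) (by linarith) (B := B) hdp (by linarith) hs, neg_lt_zero]
    refine mul_pos (by positivity) ?_
    have hy : 0 < s / 2 / B := by positivity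
    have hyx : 3 / 2 * (s / 2 / B) ≤ s / 2 := by
      rw [← mul_div_assoc, div_le_iff₀ hB0]
      nlinarith
    have h := integral_add_three_sub_mul_gammaKernel_lower hp hy
      (by rw [div_le_iff₀ hB0, ← sub_nonneg]; nlinarith) hyx le_rfl
    rw [intervalIntegral.integral_same, mul_zero, zero_add] at h
    exact (gammaKernel_pos _ (by positivity)).trans_le h
  · have hs : 0 < s := by linarith
    rw [Delta_eq (by omega) (by linarith) (B := B) hdp (by linarith) hs, neg_div, neg_lt_neg_iff]
    have h := Gamma_add_one_le_five_mul (x := s / 2) (y := s / 2 / B) hp (by positivity)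
      (by rw [div_le_iff₀ hB0]; nlinarith) (by linarith)
    have hG : Real.Gamma (p + 3) = (p + 2) * ((p + 1) * Real.Gamma (p + 1)) := by
      rw [← Real.Gamma_add_one (by linarith : 0 < p + 1).ne', show p + 1 + 1 = p + 2 by ring,
        ← Real.Gamma_add_one (by linarith : 0 < p + 2).ne', show p + 2 + 1 = p + 3 by ring]
    have hΓ₁ : 0 < Real.Gamma (p + 1) := Real.Gamma_pos_of_pos (by linarith)
    set I := ∫ u in (s / 2 / B)..(s / 2), (p + 3 - u) * gammaKernel p u
    have hlt : Real.Gamma (p + 3) < 6 * (p + 3) ^ 2 * I := by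
      rw [hG]
      nlinarith [mul_le_mul_of_nonneg_left h (sq_nonneg (p + 3)), mul_pos hΓ₁ (by linarith : 0 < p),
        mul_pos (sq_pos_of_pos (by linarith : 0 < p + 3)) (by linarith : 0 < I)]
    rw [hdp, div_mul_eq_mul_div, div_lt_div_iff₀ (by positivity) hΓ]
    nlinarith [mul_lt_mul_of_pos_left hlt hs]
end

section
/- There exists a constant d₀ such that the following holds (Conditional Expectation Lemma, concrete spherical form). Let d ≥ d₀ be an integer and B ≥ 4. Let f: ℝ^d → {0,1} be measurable, and define h(s) = ∫_{S^{d−1}} f(√s·ω) dμ(ω) for s > 0, where μ is the uniform probability measure on the unit sphere S^{d−1} ⊆ ℝ^d (so h(s) is the average of f over the sphere of radius √s). Assume f is B-sound, i.e. (i) ∫_{Bd/2}^{2Bd} (1−h(s)) ds ≤ 1/(Bd) and (ii) ∫_0^{2d} h(s) ds ≤ 1/d. Then there exists τ ∈ [d, Bd] such that, writing g ∼ N(0, τ/d)^d, one has E[‖g‖²·f(g)] ≥ (τ + 1/(4B))·P(f(g)=1) and P(f(g)=1) ≥ 1/(40B²d). -/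
open MeasureTheory ProbabilityTheory Real

/-- The law `N(0,σ²)^n` of a random vector of `ℝⁿ` with `n` independent centered Gaussian
coordinates of variance `σ²`. -/
noncomputable def gaussianE (n : ℕ) (σ2 : ℝ) : Measure (EuclideanSpace ℝ (Fin n)) :=
  Measure.map (⇑(EuclideanSpace.equiv (Fin n) ℝ).symm)
    (Measure.pi fun _ : Fin n => gaussianReal 0 (Real.toNNReal σ2))

/-- The uniform probability measure on the unit sphere of `ℝ^d`. -/
noncomputable def sphereUniform (d : ℕ) :
    Measure (Metric.sphere (0 : EuclideanSpace ℝ (Fin d)) 1) :=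
  ((volume : Measure (EuclideanSpace ℝ (Fin d))).toSphere Set.univ)⁻¹ •
    (volume : Measure (EuclideanSpace ℝ (Fin d))).toSphere

/-- The average of `f` over the sphere of radius `√s` centered at the origin. -/
noncomputable def sphAvg (d : ℕ) (f : EuclideanSpace ℝ (Fin d) → ℝ) (s : ℝ) : ℝ :=
  ∫ ω, f (Real.sqrt s • (ω : EuclideanSpace ℝ (Fin d))) ∂(sphereUniform d)

lemma gaussianE_eq_withDensity (d : ℕ) {v : ℝ} (hv : 0 < v) :
    gaussianE d v = (volume : Measure (EuclideanSpace ℝ (Fin d))).withDensity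
      fun x => ENNReal.ofReal ((2 * π * v) ^ (-(d / 2 : ℝ)) * exp (-(1 / (2 * v) * ‖x‖ ^ 2))) := by
  have hv' : Real.toNNReal v ≠ 0 := by simpa using hv
  have hpi : (Measure.pi fun _ : Fin d => gaussianReal 0 (Real.toNNReal v)) =
      (volume : Measure (Fin d → ℝ)).withDensity
        fun x => ENNReal.ofReal (∏ i, gaussianPDFReal 0 (Real.toNNReal v) (x i)) := by
    refine (Measure.pi_eq fun s hs => ?_)
    rw [withDensity_apply _ (MeasurableSet.univ_pi hs), volume_pi, Measure.restrict_pi_pi,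
      ← ofReal_integral_eq_lintegral_ofReal, integral_fintype_prod_eq_prod,
      ENNReal.ofReal_prod_of_nonneg]
    · refine Finset.prod_congr rfl fun i _ => ?_
      rw [gaussianReal_apply_eq_integral _ hv']
    · exact fun i _ => integral_nonneg fun x => gaussianPDFReal_nonneg _ _ _
    · exact Integrable.fintype_prod fun i => (integrable_gaussianPDFReal _ _).restrict
    · exact ae_of_all _ fun x => Finset.prod_nonneg fun i _ => gaussianPDFReal_nonneg _ _ _
  have hprod (x : EuclideanSpace ℝ (Fin d)) :
      ∏ i, gaussianPDFReal 0 (Real.toNNReal v) (x i) =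
        (2 * π * v) ^ (-(d / 2 : ℝ)) * exp (-(1 / (2 * v) * ‖x‖ ^ 2)) := by
    simp only [gaussianPDFReal, Finset.prod_mul_distrib, ← exp_sum, EuclideanSpace.norm_sq_eq,
      Real.coe_toNNReal v hv.le, Finset.prod_const, Finset.card_univ, Fintype.card_fin]
    congr 1
    · rw [sqrt_eq_rpow, ← rpow_neg (by positivity), ← rpow_natCast, ← rpow_mul (by positivity)]
      congr 1; ring
    · congr 1
      rw [Finset.mul_sum, ← Finset.sum_neg_distrib]
      refine Finset.sum_congr rfl fun i _ => ?_
      simp; ring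
  have hmp := PiLp.volume_preserving_toLp (Fin d)
  have hme : Measurable fun x : EuclideanSpace ℝ (Fin d) =>
      ENNReal.ofReal (∏ i, gaussianPDFReal 0 (Real.toNNReal v) (x i)) := by
    simp_rw [hprod]; fun_prop
  simp_rw [← hprod]
  rw [gaussianE, hpi]
  ext s hs
  have hcoe : (⇑(EuclideanSpace.equiv (Fin d) ℝ).symm) = WithLp.toLp 2 := rfl
  rw [hcoe, Measure.map_apply hmp.measurable hs,
    withDensity_apply _ (hmp.measurable hs), withDensity_apply _ hs,
    ← hmp.setLIntegral_comp_preimage hs hme]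

lemma integral_gaussianE (d : ℕ) {v : ℝ} (hv : 0 < v) (F : EuclideanSpace ℝ (Fin d) → ℝ) :
    ∫ x, F x ∂(gaussianE d v) = (2 * π * v) ^ (-(d / 2 : ℝ)) *
      ∫ x, exp (-(1 / (2 * v) * ‖x‖ ^ 2)) * F x := by
  rw [gaussianE_eq_withDensity d hv, integral_withDensity_eq_integral_toReal_smul (by fun_prop)
    (ae_of_all _ fun _ => ENNReal.ofReal_lt_top), ← integral_const_mul]
  refine integral_congr_ae (ae_of_all _ fun x => ?_)
  dsimp only
  rw [ENNReal.toReal_ofReal (by positivity), smul_eq_mul, mul_assoc]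

instance (d : ℕ) : IsFiniteMeasure (sphereUniform d) := by
  unfold sphereUniform; infer_instance

instance (d : ℕ) [NeZero d] : IsProbabilityMeasure (sphereUniform d) := by
  have : NeZero (volume : Measure (EuclideanSpace ℝ (Fin d))).toSphere :=
    ⟨Measure.toSphere_ne_zero _⟩
  unfold sphereUniform; infer_instance

lemma integral_toSphere (d : ℕ) [NeZero d]
    (F : Metric.sphere (0 : EuclideanSpace ℝ (Fin d)) 1 → ℝ) :
    ∫ ω, F ω ∂(volume : Measure (EuclideanSpace ℝ (Fin d))).toSphere =
      (volume : Measure (EuclideanSpace ℝ (Fin d))).toSphere.real Set.univ *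
        ∫ ω, F ω ∂(sphereUniform d) := by
  have h : (volume : Measure (EuclideanSpace ℝ (Fin d))).toSphere.real Set.univ ≠ 0 := by
    rw [Measure.real, ENNReal.toReal_ne_zero]
    exact ⟨by simpa only [ne_eq, Measure.measure_univ_eq_zero] using Measure.toSphere_ne_zero _,
      measure_ne_top _ _⟩
  rw [sphereUniform, integral_smul_measure, ENNReal.toReal_inv, ← Measure.real, smul_eq_mul,
    mul_inv_cancel_left₀ h]

lemma measurable_sphAvg {d : ℕ} {f : EuclideanSpace ℝ (Fin d) → ℝ} (hf : Measurable f) :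
    Measurable (sphAvg d f) := by
  refine (StronglyMeasurable.integral_prod_right (ν := sphereUniform d)
    (f := fun (s : ℝ) (ω : Metric.sphere (0 : EuclideanSpace ℝ (Fin d)) 1) =>
      f (Real.sqrt s • (ω : EuclideanSpace ℝ (Fin d)))) ?_).measurable
  refine (hf.comp ?_).stronglyMeasurable
  fun_prop

/-- Integration in polar coordinates. -/
lemma integral_eq_integral_Ioi_integral_toSphere {d : ℕ} [NeZero d]
    {F : EuclideanSpace ℝ (Fin d) → ℝ} (hF : Integrable F) :
    ∫ x, F x = ∫ r in Set.Ioi (0 : ℝ), r ^ (d - 1) *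
      ∫ ω, F (r • (ω : EuclideanSpace ℝ (Fin d)))
        ∂(volume : Measure (EuclideanSpace ℝ (Fin d))).toSphere := by
  have hmp := (volume : Measure (EuclideanSpace ℝ (Fin d))).measurePreserving_homeomorphUnitSphereProd
  have hemb := (homeomorphUnitSphereProd (EuclideanSpace ℝ (Fin d))).measurableEmbedding
  set G : Metric.sphere (0 : EuclideanSpace ℝ (Fin d)) 1 × Set.Ioi (0 : ℝ) → ℝ :=
    fun p => F ((p.2 : ℝ) • (p.1 : EuclideanSpace ℝ (Fin d))) with hG
  have hcomp : ∀ x : ({0}ᶜ : Set (EuclideanSpace ℝ (Fin d))),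
      G (homeomorphUnitSphereProd _ x) = F x := by
    intro x
    simp only [hG]
    have hx : ‖(x : EuclideanSpace ℝ (Fin d))‖ ≠ 0 := norm_ne_zero_iff.2 x.2
    simp [smul_smul, hx]
  have h1 : ∫ x, F x = ∫ p, G p ∂((volume : Measure (EuclideanSpace ℝ (Fin d))).toSphere.prod
      (Measure.volumeIoiPow (Module.finrank ℝ (EuclideanSpace ℝ (Fin d)) - 1))) := by
    rw [← hmp.integral_comp hemb]
    simp_rw [hcomp]
    rw [integral_subtype_comap (measurableSet_singleton _).compl F,
      restrict_compl_singleton]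
  have hGi : Integrable G ((volume : Measure (EuclideanSpace ℝ (Fin d))).toSphere.prod
      (Measure.volumeIoiPow (Module.finrank ℝ (EuclideanSpace ℝ (Fin d)) - 1))) := by
    rw [← hmp.integrable_comp_emb hemb]
    have : G ∘ homeomorphUnitSphereProd _ = F ∘ (Subtype.val) := funext hcomp
    rw [this, ← integrableOn_iff_comap_subtypeVal (measurableSet_singleton _).compl]
    exact hF.integrableOn
  rw [h1, integral_prod_symm _ hGi, finrank_euclideanSpace_fin]
  simp only [Measure.volumeIoiPow, ENNReal.ofReal]
  rw [integral_withDensity_eq_integral_smul (measurable_subtype_coe.pow_const _).real_toNNReal,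
    integral_subtype_comap measurableSet_Ioi fun r : ℝ => Real.toNNReal (r ^ (d - 1)) •
      ∫ ω, F (r • (ω : EuclideanSpace ℝ (Fin d)))
        ∂(volume : Measure (EuclideanSpace ℝ (Fin d))).toSphere]
  refine setIntegral_congr_fun measurableSet_Ioi fun r hr => ?_
  rw [NNReal.smul_def, Real.coe_toNNReal _ (pow_nonneg (le_of_lt hr) _), smul_eq_mul]

lemma integral_radial_mul {d : ℕ} [NeZero d] {f : EuclideanSpace ℝ (Fin d) → ℝ} {G : ℝ → ℝ}
    (hG : Integrable fun x : EuclideanSpace ℝ (Fin d) => G (‖x‖ ^ 2) * f x) :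
    ∫ x : EuclideanSpace ℝ (Fin d), G (‖x‖ ^ 2) * f x =
      (volume : Measure (EuclideanSpace ℝ (Fin d))).toSphere.real Set.univ / 2 *
        ∫ s in Set.Ioi (0 : ℝ), s ^ (d / 2 - 1 : ℝ) * G s * sphAvg d f s := by
  rw [integral_eq_integral_Ioi_integral_toSphere hG,
    ← integral_comp_rpow_Ioi_of_pos (p := 2)
      (g := fun s => s ^ (d / 2 - 1 : ℝ) * G s * sphAvg d f s) (by norm_num), ← integral_const_mul]
  refine setIntegral_congr_fun measurableSet_Ioi fun r (hr : 0 < r) => ?_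
  have hn : ∀ ω : Metric.sphere (0 : EuclideanSpace ℝ (Fin d)) 1,
      ‖r • (ω : EuclideanSpace ℝ (Fin d))‖ = r := fun ω => by simp [norm_smul, abs_of_pos hr]
  have hpow : r ^ (d - 1) = r * (r ^ 2) ^ (d / 2 - 1 : ℝ) := by
    rw [← rpow_natCast r 2, ← rpow_mul hr.le, ← rpow_natCast, Nat.cast_pred (NeZero.pos d),
      mul_comm, ← rpow_add_one hr.ne']
    congr 1; push_cast; ring
  have h2 : r ^ (2 : ℝ) = r ^ 2 := rpow_ofNat r 2
  have h1 : (2 - 1 : ℝ) = 1 := by norm_num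
  simp only [hn, integral_toSphere, integral_const_mul, smul_eq_mul, h1, rpow_one, h2, hpow,
    sphAvg, sqrt_sq hr.le]
  ring

lemma gaussian_average_eq {d : ℕ} [NeZero d] {f : EuclideanSpace ℝ (Fin d) → ℝ}
    (hf : Measurable f) (hf1 : ∀ x, |f x| ≤ 1) {b : ℝ} (hb : 0 < b) :
    (b / π) ^ (d / 2 : ℝ) * ∫ x : EuclideanSpace ℝ (Fin d), exp (-(b * ‖x‖ ^ 2)) * f x =
      b ^ (d / 2 : ℝ) / Gamma (d / 2) *
        ∫ s in Set.Ioi (0 : ℝ), s ^ (d / 2 - 1 : ℝ) * exp (-(b * s)) * sphAvg d f s := by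
  have hd : (0 : ℝ) < d := Nat.cast_pos.2 (NeZero.pos d)
  have hint : Integrable fun x : EuclideanSpace ℝ (Fin d) => exp (-(b * ‖x‖ ^ 2)) := by
    refine Integrable.of_integral_ne_zero ?_
    simp_rw [← neg_mul]
    rw [GaussianFourier.integral_rexp_neg_mul_sq_norm hb]
    positivity
  have hS := integral_radial_mul (d := d) (f := fun _ => 1) (G := fun s => exp (-(b * s)))
    (by simpa using hint)
  have h1 : ∀ s, sphAvg d (fun _ => 1) s = 1 := fun s => by simp [sphAvg]
  simp only [h1, mul_one, integral_rpow_mul_exp_neg_mul_Ioi (half_pos hd) hb] at hS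
  simp_rw [← neg_mul] at hS
  rw [GaussianFourier.integral_rexp_neg_mul_sq_norm hb, finrank_euclideanSpace_fin] at hS
  rw [integral_radial_mul (G := fun s => exp (-(b * s)))]
  · rw [← mul_assoc]
    congr 1
    have hΓ := Gamma_pos_of_pos (half_pos hd)
    rw [div_rpow hb.le pi_pos.le]
    rw [div_rpow pi_pos.le hb.le, div_rpow zero_le_one hb.le, one_rpow] at hS
    have h3 : 0 < b ^ (d / 2 : ℝ) := by positivity
    have h4 : 0 < π ^ (d / 2 : ℝ) := by positivity
    field_simp at hS ⊢
    linarith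
  · exact hint.mul_bdd (c := 1) hf.aestronglyMeasurable (ae_of_all _ hf1)

lemma rpow_mul_exp_neg_le_Gamma {k x : ℝ} (hk : 1 ≤ k) (hx : 0 ≤ x) :
    x ^ (k - 1) * exp (-x) ≤ Gamma k := by
  rw [Gamma_eq_integral (by linarith), ← integral_exp_neg_Ioi, ← integral_const_mul]
  have hint := GammaIntegral_convergent (by linarith : 0 < k)
  calc ∫ t in Set.Ioi x, x ^ (k - 1) * exp (-t)
      ≤ ∫ t in Set.Ioi x, exp (-t) * t ^ (k - 1) := by
        refine setIntegral_mono_on ((integrableOn_exp_neg_Ioi x).const_mul _)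
          (hint.mono_set (Set.Ioi_subset_Ioi hx)) measurableSet_Ioi fun t ht => ?_
        rw [mul_comm]
        have : x ≤ t := le_of_lt ht
        gcongr
    _ ≤ ∫ t in Set.Ioi 0, exp (-t) * t ^ (k - 1) := by
        refine setIntegral_mono_set hint ?_ (Set.Ioi_subset_Ioi hx).eventuallyLE
        filter_upwards [ae_restrict_mem measurableSet_Ioi] with t ht
        have : 0 < t := ht
        positivity

lemma integrableOn_rpow_mul_exp {a b : ℝ} (ha : 0 < a) (hb : 0 < b) :
    IntegrableOn (fun s : ℝ => s ^ (a - 1) * exp (-(b * s))) (Set.Ioi 0) := by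
  refine Integrable.of_integral_ne_zero ?_
  rw [integral_rpow_mul_exp_neg_mul_Ioi ha hb]
  have := Gamma_pos_of_pos ha
  positivity

/-- The variance of the Gamma distribution. -/
lemma integral_gamma_variance {k b : ℝ} (hk : 0 < k) (hb : 0 < b) :
    IntegrableOn (fun s : ℝ => s ^ (k - 1) * exp (-(b * s)) * (s - k / b) ^ 2) (Set.Ioi 0) ∧
    b ^ k / Gamma k * ∫ s in Set.Ioi (0 : ℝ), s ^ (k - 1) * exp (-(b * s)) * (s - k / b) ^ 2 =
      k / b ^ 2 := by
  have h0 := integrableOn_rpow_mul_exp hk hb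
  have h1 := (integrableOn_rpow_mul_exp (by linarith : 0 < k + 1) hb).const_mul (2 * (k / b))
  have h2 := integrableOn_rpow_mul_exp (by linarith : 0 < k + 2) hb
  have h0' := h0.const_mul ((k / b) ^ 2)
  have heq : Set.EqOn (fun s : ℝ => s ^ (k - 1) * exp (-(b * s)) * (s - k / b) ^ 2)
      (fun s => s ^ (k + 2 - 1) * exp (-(b * s)) - 2 * (k / b) *
        (s ^ (k + 1 - 1) * exp (-(b * s))) + (k / b) ^ 2 * (s ^ (k - 1) * exp (-(b * s))))
      (Set.Ioi 0) := by
    intro s (hs : 0 < s)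
    have e1 : s ^ (k + 1 - 1) = s ^ (k - 1) * s := by
      rw [← rpow_add_one hs.ne']; congr 1; ring
    have e2 : s ^ (k + 2 - 1) = s ^ (k - 1) * s ^ 2 := by
      rw [← rpow_add_natCast hs.ne']; congr 1; push_cast; ring
    simp only [e1, e2]; ring
  refine ⟨((h2.sub h1).add h0').congr_fun heq.symm measurableSet_Ioi, ?_⟩
  rw [setIntegral_congr_fun measurableSet_Ioi heq, integral_add (by exact h2.sub h1) h0',
    integral_sub h2 h1, integral_const_mul, integral_const_mul,
    integral_rpow_mul_exp_neg_mul_Ioi (by linarith) hb,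
    integral_rpow_mul_exp_neg_mul_Ioi (by linarith) hb,
    integral_rpow_mul_exp_neg_mul_Ioi hk hb]
  have g2 : Gamma (k + 2) = (k + 1) * (k * Gamma k) := by
    rw [show k + 2 = (k + 1) + 1 by ring, Gamma_add_one (by linarith), Gamma_add_one hk.ne']
  have p1 : (1 / b) ^ (k + 1) = (b ^ k)⁻¹ * b⁻¹ := by
    rw [one_div, rpow_add_one (by positivity), inv_rpow hb.le]
  have p2 : (1 / b) ^ (k + 2) = (b ^ k)⁻¹ * b⁻¹ ^ 2 := by
    rw [one_div, show (2 : ℝ) = (2 : ℕ) by norm_num, rpow_add_natCast (by positivity),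
      inv_rpow hb.le]
  have p0 : (1 / b) ^ k = (b ^ k)⁻¹ := by rw [one_div, inv_rpow hb.le]
  rw [g2, Gamma_add_one hk.ne', p0, p1, p2]
  have h3 : 0 < b ^ k := by positivity
  have hΓ := Gamma_pos_of_pos hk
  field_simp
  ring

/-- If `0 ≤ h ≤ 1`, the mean of `h` under a Gamma distribution is controlled by the integral of `h`
over an interval around the mean of the distribution. -/
lemma gamma_average_le {k b : ℝ} (hk : 1 ≤ k) (hb : 0 < b) {h : ℝ → ℝ} (hm : Measurable h)
    (h0 : ∀ s, 0 ≤ h s) (h1 : ∀ s, h s ≤ 1) {l u : ℝ} (hl : 0 ≤ l) (hlk : l ≤ k / b / 2)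
    (hu : 3 / 2 * (k / b) ≤ u) :
    b ^ k / Gamma k * ∫ s in Set.Ioi (0 : ℝ), s ^ (k - 1) * exp (-(b * s)) * h s ≤
      4 / k + b * ∫ s in l..u, h s := by
  have hk0 : 0 < k := by linarith
  have hkb : 0 < k / b := by positivity
  have hΓ := Gamma_pos_of_pos hk0
  have hlu : l ≤ u := by linarith
  obtain ⟨hvi, hv⟩ := integral_gamma_variance hk0 hb
  have hhi : IntegrableOn h (Set.Ioc l u) :=
    Measure.integrableOn_of_bounded (M := 1) (by simp) hm.aestronglyMeasurable
      (ae_of_all _ fun s => by simpa [abs_of_nonneg (h0 s)] using h1 s)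
  have hsub : Set.Ioc l u ⊆ Set.Ioi 0 := fun s hs => lt_of_le_of_lt hl hs.1
  have hind : IntegrableOn ((Set.Ioc l u).indicator fun s => b * h s) (Set.Ioi 0) :=
    ((integrable_indicator_iff measurableSet_Ioc).2 (hhi.const_mul b)).integrableOn
  have hvi' := (hvi.const_mul (b ^ k / Gamma k)).const_mul (4 / (k / b) ^ 2)
  have hint : IntegrableOn (fun s => s ^ (k - 1) * exp (-(b * s)) * h s) (Set.Ioi 0) :=
    (integrableOn_rpow_mul_exp hk0 hb).mul_bdd (c := 1) hm.aestronglyMeasurable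
      (ae_of_all _ fun s => by simpa [abs_of_nonneg (h0 s)] using h1 s)
  have hR : 4 / k + b * ∫ s in l..u, h s =
      ∫ s in Set.Ioi (0 : ℝ), (4 / (k / b) ^ 2 * (b ^ k / Gamma k *
        (s ^ (k - 1) * exp (-(b * s)) * (s - k / b) ^ 2)) +
        (Set.Ioc l u).indicator (fun s => b * h s) s) := by
    rw [integral_add hvi' hind, integral_const_mul, integral_const_mul, hv,
      setIntegral_indicator measurableSet_Ioc, Set.inter_eq_right.2 hsub, integral_const_mul,
      intervalIntegral.integral_of_le hlu]
    congr 1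
    field_simp
  rw [hR, ← integral_const_mul]
  refine setIntegral_mono_on (hint.const_mul _) (hvi'.add hind) measurableSet_Ioi
    fun s (hs : 0 < s) => ?_
  have hρ : 0 ≤ b ^ k / Gamma k * (s ^ (k - 1) * exp (-(b * s))) := by positivity
  have hh0 := h0 s
  have hh1 := h1 s
  by_cases hsI : s ∈ Set.Ioc l u
  · rw [Set.indicator_of_mem hsI]
    have hG := rpow_mul_exp_neg_le_Gamma hk (by positivity : 0 ≤ b * s)
    have : b ^ k / Gamma k * (s ^ (k - 1) * exp (-(b * s))) ≤ b := by
      rw [div_mul_eq_mul_div, div_le_iff₀ hΓ]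
      refine le_trans (le_of_eq ?_) (mul_le_mul_of_nonneg_left hG hb.le)
      rw [mul_rpow hb.le hs.le, rpow_sub_one hb.ne']
      field_simp
    have h3 := mul_le_mul_of_nonneg_right this hh0
    have h4 : 0 ≤ 4 / (k / b) ^ 2 * (b ^ k / Gamma k *
        (s ^ (k - 1) * exp (-(b * s)) * (s - k / b) ^ 2)) := by positivity
    linarith
  · rw [Set.indicator_of_notMem hsI, add_zero]
    have hsq : 1 ≤ 4 / (k / b) ^ 2 * (s - k / b) ^ 2 := by
      rw [div_mul_eq_mul_div, one_le_div (by positivity)]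
      rcases le_or_gt s l with h | h
      · nlinarith
      · have : u < s := by
          by_contra hc
          exact hsI ⟨h, not_lt.1 hc⟩
        nlinarith
    calc b ^ k / Gamma k * (s ^ (k - 1) * exp (-(b * s)) * h s)
        = b ^ k / Gamma k * (s ^ (k - 1) * exp (-(b * s))) * h s := by ring
      _ ≤ b ^ k / Gamma k * (s ^ (k - 1) * exp (-(b * s))) *
          (4 / (k / b) ^ 2 * (s - k / b) ^ 2) := by gcongr; linarith
      _ = _ := by ring

lemma hasDerivAt_gaussian_average {d : ℕ} [NeZero d] {f : EuclideanSpace ℝ (Fin d) → ℝ}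
    (hf : Measurable f) (hf01 : ∀ x, f x = 0 ∨ f x = 1) {τ : ℝ} (hτ : 0 < τ) :
    HasDerivAt (fun t => ∫ x, f x ∂(gaussianE d (t / d)))
      (d / (2 * τ ^ 2) * (∫ x, ‖x‖ ^ 2 * f x ∂(gaussianE d (τ / d)) -
        τ * ∫ x, f x ∂(gaussianE d (τ / d)))) τ := by
  have hd : (0 : ℝ) < d := Nat.cast_pos.2 (NeZero.pos d)
  set μ : Measure (EuclideanSpace ℝ (Fin d)) := volume.restrict {x | f x = 1} with hμ
  set X : EuclideanSpace ℝ (Fin d) → ℝ := fun x => ‖x‖ ^ 2 with hX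
  have hA : MeasurableSet {x | f x = 1} := hf (measurableSet_singleton 1)
  have hres (g : EuclideanSpace ℝ (Fin d) → ℝ) : ∫ x, g x * f x = ∫ x, g x ∂μ := by
    rw [hμ, ← integral_indicator hA]
    congr 1 with x
    rcases hf01 x with h | h <;> simp [Set.indicator, h]
  have hset : Set.Iio 0 ⊆ integrableExpSet X μ := by
    intro t (ht : t < 0)
    have : Integrable (fun x : EuclideanSpace ℝ (Fin d) => exp (-(-t) * ‖x‖ ^ 2)) := by
      refine Integrable.of_integral_ne_zero ?_
      rw [GaussianFourier.integral_rexp_neg_mul_sq_norm (by linarith)]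
      have : 0 < π / -t := div_pos pi_pos (by linarith)
      positivity
    simpa [integrableExpSet, hX] using this.restrict
  have hint : ∀ t < 0, t ∈ interior (integrableExpSet X μ) := fun t ht =>
    interior_mono hset (by rwa [interior_Iio])
  have hmean : ∀ t, 0 < t → ∫ x, f x ∂(gaussianE d (t / d)) =
      (2 * π * (t / d)) ^ (-(d / 2 : ℝ)) * mgf X μ (-(d / (2 * t))) := by
    intro t ht
    rw [integral_gaussianE d (by positivity), hres, mgf]
    congr 2 with x
    congr 1
    simp only [hX]
    field_simp
  have hmom : ∫ x, ‖x‖ ^ 2 * f x ∂(gaussianE d (τ / d)) =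
      (2 * π * (τ / d)) ^ (-(d / 2 : ℝ)) * μ[fun x => X x * exp (-(d / (2 * τ)) * X x)] := by
    rw [integral_gaussianE d (by positivity)]
    simp_rw [← mul_assoc]
    rw [hres]
    congr 2 with x
    rw [mul_comm]
    congr 2
    simp only [hX]
    field_simp
  have hin : HasDerivAt (fun t : ℝ => -(d / (2 * t))) (d / (2 * τ ^ 2)) τ := by
    have := ((hasDerivAt_inv hτ.ne').const_mul (-(d / 2 : ℝ)))
    refine (this.congr_deriv (by field_simp)).congr_of_eventuallyEq
      (Filter.Eventually.of_forall fun t => ?_)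
    simp only [div_eq_mul_inv, mul_inv]; ring
  have hM := (hasDerivAt_mgf (hint (-(d / (2 * τ)))
    (neg_lt_zero.2 (by positivity)))).comp τ hin
  have hC : HasDerivAt (fun t : ℝ => (2 * π * (t / d)) ^ (-(d / 2 : ℝ)))
      ((2 * π * (τ / d)) ^ (-(d / 2 : ℝ)) * (-(d / 2) / τ)) τ := by
    have h1 : HasDerivAt (fun t : ℝ => 2 * π * (t / d)) (2 * π * (1 / d)) τ :=
      ((hasDerivAt_id τ).div_const _).const_mul _
    refine (h1.rpow_const (Or.inl (by positivity))).congr_deriv ?_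
    rw [rpow_sub_one (by positivity)]
    field_simp
  refine ((hC.mul hM).congr_of_eventuallyEq ?_).congr_deriv ?_
  · filter_upwards [lt_mem_nhds hτ] with t ht
    exact hmean t ht
  · rw [hmom, hmean τ hτ]
    simp only [Function.comp]
    field_simp
    ring

lemma gaussian_average_le {d : ℕ} (hd : 2 ≤ d) {f : EuclideanSpace ℝ (Fin d) → ℝ}
    (hf : Measurable f) (hf01 : ∀ x, f x = 0 ∨ f x = 1) {τ l u : ℝ} (hτ : 0 < τ) (hl : 0 ≤ l)
    (hlτ : l ≤ τ / 2) (hu : 3 / 2 * τ ≤ u) :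
    ∫ x, f x ∂(gaussianE d (τ / d)) ≤ 8 / d + d / (2 * τ) * ∫ s in l..u, sphAvg d f s := by
  have : NeZero d := ⟨by omega⟩
  have hd2 : (2 : ℝ) ≤ d := by exact_mod_cast hd
  have hd0 : (0 : ℝ) < d := by linarith
  have hf0 : ∀ x, 0 ≤ f x := fun x => by rcases hf01 x with h | h <;> simp [h]
  have hf1 : ∀ x, f x ≤ 1 := fun x => by rcases hf01 x with h | h <;> simp [h]
  have hk : (d / 2 : ℝ) / (d / (2 * τ)) = τ := by field_simp
  have key := gamma_average_le (k := d / 2) (b := d / (2 * τ)) (h := sphAvg d f) (u := u) (by linarith)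
    (by positivity) (measurable_sphAvg hf) (fun s => integral_nonneg fun _ => hf0 _)
    (fun s => by
      refine (integral_mono_of_nonneg (ae_of_all _ fun _ => hf0 _) (integrable_const (1 : ℝ))
        (ae_of_all _ fun _ => hf1 _)).trans (by simp)) hl (by rwa [hk]) (by rwa [hk])
  rw [← gaussian_average_eq hf (fun x => by rw [abs_of_nonneg (hf0 x)]; exact hf1 x)
    (by positivity)] at key
  have hb : 1 / (2 * (τ / d)) = d / (2 * τ) := by field_simp
  rw [integral_gaussianE d (by positivity), hb]
  have h8 : 4 / (d / 2 : ℝ) = 8 / d := by field_simp; norm_num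
  have hc : (2 * π * (τ / d)) ^ (-(d / 2 : ℝ)) = (d / (2 * τ) / π) ^ (d / 2 : ℝ) := by
    rw [rpow_neg (by positivity), ← inv_rpow (by positivity)]
    congr 1; field_simp
  rw [hc, ← h8]
  exact key

instance (d : ℕ) (v : ℝ) : IsProbabilityMeasure (gaussianE d v) :=
  Measure.isProbabilityMeasure_map (by fun_prop)

lemma integral_eq_measure_setOf_eq_one {Ω : Type*} [MeasurableSpace Ω] (μ : Measure Ω)
    {f : Ω → ℝ} (hf : Measurable f) (hf01 : ∀ x, f x = 0 ∨ f x = 1) :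
    ∫ x, f x ∂μ = (μ {x | f x = 1}).toReal := by
  rw [← Measure.real, ← integral_indicator_one (s := {x | f x = 1}) (hf (measurableSet_singleton 1))]
  congr 1 with x
  rcases hf01 x with h | h <;> simp [Set.indicator, h]

/-- A differentiable function climbing from at most `1/4` to at least `1/2` has a large derivative
at a point where its value is at least `1/4`. -/
lemma exists_deriv_ge_of_le_of_ge {p p' : ℝ → ℝ} {a b : ℝ} (hab : a ≤ b)
    (hp : ∀ t ∈ Set.Icc a b, HasDerivAt p (p' t) t) (ha : p a ≤ 1 / 4) (hb : 1 / 2 ≤ p b) :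
    ∃ t ∈ Set.Icc a b, 1 / 4 ≤ p t ∧ 1 / 4 ≤ p' t * (b - a) := by
  have hcont : ContinuousOn p (Set.Icc a b) := fun t ht => (hp t ht).continuousAt.continuousWithinAt
  set S := Set.Icc a b ∩ p ⁻¹' Set.Iic (1 / 4) with hS
  have hcl : IsClosed S := hcont.preimage_isClosed_of_isClosed isClosed_Icc isClosed_Iic
  have hbdd : BddAbove S := ⟨b, fun t ht => ht.1.2⟩
  have hne : S.Nonempty := ⟨a, ⟨le_rfl, hab⟩, ha⟩
  obtain ⟨⟨hca, hcb⟩, hpc⟩ : sSup S ∈ S := hcl.csSup_mem hne hbdd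
  set c := sSup S with hc
  have hpc' : p c ≤ 1 / 4 := hpc
  have hlt : c < b := lt_of_le_of_ne hcb fun h => by rw [h] at hpc'; linarith
  obtain ⟨t, ⟨hct, htb⟩, ht⟩ := exists_hasDerivAt_eq_slope p p' hlt
    (hcont.mono (Set.Icc_subset_Icc hca le_rfl))
    fun x hx => hp x ⟨hca.trans hx.1.le, hx.2.le⟩
  refine ⟨t, ⟨hca.trans hct.le, htb.le⟩, ?_, ?_⟩
  · by_contra h
    exact absurd (le_csSup hbdd ⟨⟨hca.trans hct.le, htb.le⟩, (not_le.1 h).le⟩) (not_le.2 hct)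
  · rw [eq_div_iff (by linarith)] at ht
    have hpos : 0 ≤ p' t := by
      by_contra h
      nlinarith
    nlinarith

theorem stmt6 :
    ∃ d₀ : ℕ, ∀ d : ℕ, d₀ ≤ d → ∀ B : ℝ, 4 ≤ B →
      ∀ f : EuclideanSpace ℝ (Fin d) → ℝ, Measurable f → (∀ x, f x = 0 ∨ f x = 1) →
      (∫ s in (B * d / 2)..(2 * B * d), (1 - sphAvg d f s)) ≤ 1 / (B * d) →
      (∫ s in (0 : ℝ)..(2 * d), sphAvg d f s) ≤ 1 / d →
      ∃ τ ∈ Set.Icc (d : ℝ) (B * d),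
        (τ + 1 / (4 * B)) * ((gaussianE d (τ / d)) {x | f x = 1}).toReal ≤
          (∫ x, ‖x‖ ^ 2 * f x ∂(gaussianE d (τ / d))) ∧
        1 / (40 * B ^ 2 * d) ≤ ((gaussianE d (τ / d)) {x | f x = 1}).toReal := by
  refine ⟨100, fun d hd B hB f hf hf01 h1 h2 => ?_⟩
  have : NeZero d := ⟨by omega⟩
  have hd' : (100 : ℝ) ≤ d := by exact_mod_cast hd
  have hd0 : (0 : ℝ) < d := by linarith
  have hB0 : 0 < B := by linarith
  have hfb : ∀ x, |f x| ≤ 1 := fun x => by rcases hf01 x with h | h <;> simp [h]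
  have h8d : 8 / (d : ℝ) ≤ 8 / 100 := by gcongr
  have h1d : 1 / (d : ℝ) ≤ 1 / 100 := by gcongr
  have hlow : ∫ x, f x ∂(gaussianE d ((d : ℝ) / d)) ≤ 1 / 4 := by
    have := gaussian_average_le (by omega) hf hf01 hd0 le_rfl (by positivity)
      (by linarith : 3 / 2 * (d : ℝ) ≤ 2 * d)
    have e : (d : ℝ) / (2 * d) = 1 / 2 := by field_simp
    rw [e] at this
    linarith
  have hhigh : 1 / 2 ≤ ∫ x, f x ∂(gaussianE d (B * d / d)) := by
    have := gaussian_average_le (f := fun x => 1 - f x) (by omega) (measurable_const.sub hf)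
      (fun x => by rcases hf01 x with h | h <;> simp [h]) (by positivity : 0 < B * d)
      (by positivity) le_rfl (by nlinarith : 3 / 2 * (B * d) ≤ 2 * B * d)
    have hsph : ∀ s, sphAvg d (fun x => 1 - f x) s = 1 - sphAvg d f s := fun s => by
      rw [sphAvg, integral_sub (integrable_const _), sphAvg]
      · simp
      · exact Integrable.of_bound (hf.comp (by fun_prop)).aestronglyMeasurable 1
          (ae_of_all _ fun _ => hfb _)
    simp only [hsph] at this
    rw [integral_sub (integrable_const _)
      (Integrable.of_bound hf.aestronglyMeasurable 1 (ae_of_all _ hfb))] at this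
    have e : (d : ℝ) / (2 * (B * d)) ≤ 1 / 8 := by
      rw [div_le_div_iff₀ (by positivity) (by norm_num)]; nlinarith
    have e2 : 1 / (B * d) ≤ 1 / 400 := by
      gcongr; nlinarith
    have e3 : (d : ℝ) / (2 * (B * d)) * ∫ s in (B * d / 2)..(2 * B * d), (1 - sphAvg d f s) ≤
        1 / 8 * (1 / 400) :=
      (mul_le_mul_of_nonneg_left (h1.trans e2) (by positivity)).trans
        (mul_le_mul_of_nonneg_right e (by norm_num))
    simp only [integral_const, probReal_univ, smul_eq_mul, mul_one] at this
    linarith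
  have hdB : (d : ℝ) ≤ B * d := by nlinarith
  obtain ⟨τ, hτ, hpτ, hder⟩ := exists_deriv_ge_of_le_of_ge
    (p := fun t => ∫ x, f x ∂(gaussianE d (t / d))) hdB
    (fun t ht => hasDerivAt_gaussian_average hf hf01 (hd0.trans_le ht.1)) hlow hhigh
  refine ⟨τ, hτ, ?_⟩
  have hτ0 : 0 < τ := hd0.trans_le hτ.1
  have hp1 : ∫ x, f x ∂(gaussianE d (τ / d)) ≤ 1 := by
    rw [integral_eq_measure_setOf_eq_one _ hf hf01]
    exact measureReal_le_one
  rw [← integral_eq_measure_setOf_eq_one _ hf hf01]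
  set P := ∫ x, f x ∂(gaussianE d (τ / d))
  set E := ∫ x, ‖x‖ ^ 2 * f x ∂(gaussianE d (τ / d))
  constructor
  · have hpos : 0 < E - τ * P := by
      by_contra h
      have : (d : ℝ) / (2 * τ ^ 2) * (E - τ * P) ≤ 0 :=
        mul_nonpos_of_nonneg_of_nonpos (by positivity) (not_lt.1 h)
      nlinarith
    have h3 : (d : ℝ) / (2 * τ ^ 2) ≤ 1 / (2 * d) := by
      rw [div_le_div_iff₀ (by positivity) (by positivity)]
      nlinarith [hτ.1]
    have h4 : 1 / 4 ≤ 1 / (2 * d) * (E - τ * P) * (B * d) :=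
      hder.trans (mul_le_mul (mul_le_mul_of_nonneg_right h3 hpos.le) (by linarith)
        (by linarith) (by positivity))
    have h5 : 1 / (2 * d) * (E - τ * P) * (B * d) = (E - τ * P) * B / 2 := by field_simp
    rw [h5] at h4
    have h6 : 1 / (4 * B) * P ≤ 1 / (4 * B) * 1 := by gcongr
    have h7 : 1 / (4 * B) ≤ E - τ * P := by
      rw [div_le_iff₀ (by positivity)]; linarith
    linarith
  · refine le_trans ?_ hpτ
    gcongr
    nlinarith
end

section
/- Let n ≥ 1, let v ∈ ℝⁿ, and let σ > 0. Then the total variation distance between the Gaussian product measures N(0,σ²)ⁿ and N(v,σ²)ⁿ satisfies ‖N(0,σ²)ⁿ − N(v,σ²)ⁿ‖_tv ≤ ‖v‖/σ, where ‖v‖ is the Euclidean norm of v. -/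
open MeasureTheory ProbabilityTheory Real

/-- The total variation distance between two measures. -/
noncomputable def tvDist {α : Type*} [MeasurableSpace α] (μ ν : Measure α) : ℝ :=
  ⨆ s : { s : Set α // MeasurableSet s }, |(μ s).toReal - (ν s).toReal|

/-- The law `N(v,σ²)^n` of a random vector of `ℝⁿ` with `n` independent Gaussian
coordinates with means given by `v` and common variance `σ²`. -/
noncomputable def gaussianEMean (n : ℕ) (v : EuclideanSpace ℝ (Fin n)) (σ2 : ℝ) :
    Measure (EuclideanSpace ℝ (Fin n)) :=
  Measure.map (⇑(EuclideanSpace.equiv (Fin n) ℝ).symm)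
    (Measure.pi fun i : Fin n => gaussianReal (v i) (Real.toNNReal σ2))

/-- The distance `tvDist` between two measures does not increase under a measurable map. -/
lemma tvDist_map_le {α β : Type*} [MeasurableSpace α] [MeasurableSpace β] {μ ν : Measure α}
    {f : α → β} (hf : Measurable f) {c : ℝ}
    (h : ∀ s, MeasurableSet s → |μ.real s - ν.real s| ≤ c) :
    tvDist (μ.map f) (ν.map f) ≤ c := by
  have : Nonempty { s : Set β // MeasurableSet s } := ⟨⟨∅, .empty⟩⟩
  refine ciSup_le fun s ↦ ?_
  rw [Measure.map_apply hf s.2, Measure.map_apply hf s.2]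
  exact h _ (hf s.2)

lemma measureReal_withDensity_ofReal {α : Type*} [MeasurableSpace α] {μ : Measure α} {L : α → ℝ}
    (hL0 : ∀ x, 0 ≤ L x) (hL : Integrable L μ) {s : Set α} (hs : MeasurableSet s) :
    (μ.withDensity fun x ↦ ENNReal.ofReal (L x)).real s = ∫ x in s, L x ∂μ := by
  rw [measureReal_def, withDensity_apply _ hs,
    ← ofReal_integral_eq_lintegral_ofReal hL.integrableOn (ae_of_all _ hL0),
    ENNReal.toReal_ofReal (integral_nonneg hL0)]

/-- A bound on the total variation distance by the second moment of the density. -/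
lemma abs_measureReal_sub_withDensity_le {α : Type*} [MeasurableSpace α] {μ : Measure α}
    [IsProbabilityMeasure μ] {L : α → ℝ} (hL0 : ∀ x, 0 ≤ L x) (hL : Integrable L μ)
    (hL2 : Integrable (fun x ↦ L x ^ 2) μ) (hL1 : ∫ x, L x ∂μ = 1) {t : ℝ} (ht : 0 < t)
    (hLt : ∫ x, L x ^ 2 ∂μ ≤ 1 + 3 * t ^ 2) {s : Set α} (hs : MeasurableSet s) :
    |μ.real s - (μ.withDensity fun x ↦ ENNReal.ofReal (L x)).real s| ≤ t := by
  have hd : Integrable (fun x ↦ L x - 1) μ := hL.sub (integrable_const 1)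
  have hd2 : Integrable (fun x ↦ ((L x - 1) ^ 2 / t + t) / 4) μ := by
    have : Integrable (fun x ↦ ((L x ^ 2 - 2 * L x + 1) / t + t) / 4) μ := by fun_prop
    exact this.congr (ae_of_all _ fun x ↦ by simp only []; ring)
  have hbound : ∫ x, ((L x - 1) ^ 2 / t + t) / 4 ∂μ ≤ t := by
    have : ∫ x, ((L x - 1) ^ 2 / t + t) / 4 ∂μ
        = ((∫ x, L x ^ 2 ∂μ) - 2 * (∫ x, L x ∂μ) + 1) / t / 4 + t / 4 := by
      have (x : α) : ((L x - 1) ^ 2 / t + t) / 4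
          = (L x ^ 2 - 2 * L x + 1) / t / 4 + t / 4 := by ring
      simp_rw [this]
      rw [integral_add (by fun_prop) (by fun_prop), integral_div, integral_div,
        integral_add (by fun_prop) (by fun_prop), integral_sub (by fun_prop) (by fun_prop),
        integral_const_mul]
      simp
    rw [this, hL1]
    have : ((∫ x, L x ^ 2 ∂μ) - 2 * 1 + 1) / t ≤ 3 * t := by
      rw [div_le_iff₀ ht]; nlinarith
    linarith
  have hdiff : (μ.withDensity fun x ↦ ENNReal.ofReal (L x)).real s - μ.real s
      = ∫ x, (s.indicator (fun x ↦ L x - 1) x - (L x - 1) / 2) ∂μ := by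
    rw [integral_sub (hd.indicator hs) (by fun_prop), integral_indicator hs, integral_div,
      integral_sub hL (by fun_prop), hL1, measureReal_withDensity_ofReal hL0 hL hs,
      integral_sub hL.integrableOn (by fun_prop)]
    simp
  rw [abs_sub_comm, hdiff, ← Real.norm_eq_abs]
  refine (norm_integral_le_of_norm_le hd2 (ae_of_all _ fun x ↦ ?_)).trans hbound
  have h : |L x - 1| / 2 ≤ ((L x - 1) ^ 2 / t + t) / 4 := by
    have : 2 * |L x - 1| ≤ (L x - 1) ^ 2 / t + t := by
      rw [div_add' _ _ _ ht.ne', le_div_iff₀ ht, ← sq_abs]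
      nlinarith [sq_nonneg (|L x - 1| - t)]
    linarith
  refine le_trans (le_of_eq ?_) h
  by_cases hx : x ∈ s
  · simp only [hx, Set.indicator_of_mem, sub_half, norm_eq_abs, abs_div, abs_two]
  · simp [hx]

/-- A product of measures with densities has the product of the densities as a density. -/
lemma pi_withDensity_ofReal {ι : Type*} [Fintype ι] {X : ι → Type*} [∀ i, MeasurableSpace (X i)]
    {μ : ∀ i, Measure (X i)} [∀ i, SigmaFinite (μ i)] {f : ∀ i, X i → ℝ} (hf0 : ∀ i x, 0 ≤ f i x)
    (hf : ∀ i, Integrable (f i) (μ i)) :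
    Measure.pi (fun i ↦ (μ i).withDensity fun x ↦ ENNReal.ofReal (f i x))
      = (Measure.pi μ).withDensity fun x ↦ ENNReal.ofReal (∏ i, f i (x i)) := by
  have (i : ι) : IsFiniteMeasure ((μ i).withDensity fun x ↦ ENNReal.ofReal (f i x)) :=
    isFiniteMeasure_withDensity_ofReal (hf i).2
  refine Measure.pi_eq fun s hs ↦ ?_
  rw [withDensity_apply _ (.univ_pi hs), Measure.restrict_pi_pi,
    ← ofReal_integral_eq_lintegral_ofReal (.fintype_prod_dep fun i ↦ (hf i).integrableOn)
      (ae_of_all _ fun x ↦ Finset.prod_nonneg fun i _ ↦ hf0 i _),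
    integral_fintype_prod_eq_prod,
    ENNReal.ofReal_prod_of_nonneg fun i _ ↦ integral_nonneg (hf0 i)]
  refine Finset.prod_congr rfl fun i _ ↦ ?_
  rw [withDensity_apply _ (hs i), ofReal_integral_eq_lintegral_ofReal (hf i).integrableOn
    (ae_of_all _ (hf0 i))]

/-- The density of `N(m, σ²)` with respect to `N(0, σ²)`. -/
noncomputable def gaussianShiftDensity (m σ x : ℝ) : ℝ :=
  exp (m / σ ^ 2 * x - m ^ 2 / (2 * σ ^ 2))

lemma gaussianShiftDensity_nonneg (m σ x : ℝ) : 0 ≤ gaussianShiftDensity m σ x :=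
  (exp_pos _).le

lemma integral_exp_mul_sub_gaussianReal (a b σ : ℝ) :
    ∫ x, exp (a * x - b) ∂(gaussianReal 0 (σ ^ 2).toNNReal) = exp (σ ^ 2 * a ^ 2 / 2 - b) := by
  have h := mgf_gaussianReal (p := gaussianReal 0 (σ ^ 2).toNNReal) (X := id)
    (μ := 0) (v := (σ ^ 2).toNNReal) (by simp) a
  simp only [mgf, id_eq] at h
  simp_rw [exp_sub]
  rw [integral_div, h, Real.coe_toNNReal _ (sq_nonneg σ), zero_mul, zero_add]

lemma integrable_exp_mul_sub_gaussianReal (a b σ : ℝ) :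
    Integrable (fun x ↦ exp (a * x - b)) (gaussianReal 0 (σ ^ 2).toNNReal) := by
  simp_rw [exp_sub]
  exact (integrable_exp_mul_gaussianReal a).div_const _

lemma gaussianShiftDensity_sq (m σ x : ℝ) :
    gaussianShiftDensity m σ x ^ 2 = exp (2 * m / σ ^ 2 * x - m ^ 2 / σ ^ 2) := by
  rw [gaussianShiftDensity, ← exp_nat_mul]
  congr 1
  push_cast
  ring

lemma integral_gaussianShiftDensity {σ : ℝ} (hσ : 0 < σ) (m : ℝ) :
    ∫ x, gaussianShiftDensity m σ x ∂(gaussianReal 0 (σ ^ 2).toNNReal) = 1 := by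
  simp only [gaussianShiftDensity]
  rw [integral_exp_mul_sub_gaussianReal, exp_eq_one_iff]
  field_simp
  ring

lemma integral_gaussianShiftDensity_sq {σ : ℝ} (hσ : 0 < σ) (m : ℝ) :
    ∫ x, gaussianShiftDensity m σ x ^ 2 ∂(gaussianReal 0 (σ ^ 2).toNNReal)
      = exp (m ^ 2 / σ ^ 2) := by
  simp only [gaussianShiftDensity_sq]
  rw [integral_exp_mul_sub_gaussianReal]
  congr 1
  field_simp
  ring

lemma gaussianReal_eq_withDensity_gaussianShiftDensity {σ : ℝ} (hσ : 0 < σ) (m : ℝ) :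
    gaussianReal m (σ ^ 2).toNNReal = (gaussianReal 0 (σ ^ 2).toNNReal).withDensity
      fun x ↦ ENNReal.ofReal (gaussianShiftDensity m σ x) := by
  have hv : (σ ^ 2).toNNReal ≠ 0 := by simpa using hσ.ne'
  have hmeas : Measurable fun x ↦ ENNReal.ofReal (gaussianShiftDensity m σ x) := by
    unfold gaussianShiftDensity; fun_prop
  rw [gaussianReal_of_var_ne_zero _ hv, gaussianReal_of_var_ne_zero _ hv,
    ← withDensity_mul _ (measurable_gaussianPDF _ _) hmeas]
  congr 1
  ext x
  rw [Pi.mul_apply, gaussianPDF, gaussianPDF, ← ENNReal.ofReal_mul (gaussianPDFReal_nonneg _ _ _)]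
  congr 1
  rw [gaussianPDFReal, gaussianPDFReal, gaussianShiftDensity, mul_assoc (_)⁻¹, ← exp_add,
    Real.coe_toNNReal _ (sq_nonneg σ)]
  congr 2
  field_simp
  ring

theorem stmt9 (n : ℕ) (hn : 1 ≤ n) (v : EuclideanSpace ℝ (Fin n)) (σ : ℝ) (hσ : 0 < σ) :
    tvDist (gaussianEMean n 0 (σ ^ 2)) (gaussianEMean n v (σ ^ 2)) ≤ ‖v‖ / σ := by
  refine tvDist_map_le (EuclideanSpace.equiv (Fin n) ℝ).symm.continuous.measurable fun s hs ↦ ?_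
  rcases eq_or_ne v 0 with rfl | hv
  · simp
  have ht : 0 < ‖v‖ / σ := div_pos (norm_pos_iff.2 hv) hσ
  rcases le_or_gt 1 (‖v‖ / σ) with h1 | h1
  · refine le_trans (abs_sub_le_iff.2 ⟨?_, ?_⟩) h1 <;>
      exact (sub_le_self _ measureReal_nonneg).trans measureReal_le_one
  have hL (i : Fin n) : Integrable (gaussianShiftDensity (v i) σ)
      (gaussianReal 0 (σ ^ 2).toNNReal) := integrable_exp_mul_sub_gaussianReal _ _ _
  simp only [PiLp.zero_apply]
  rw [funext fun i ↦ gaussianReal_eq_withDensity_gaussianShiftDensity hσ (v i),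
    pi_withDensity_ofReal (fun i ↦ gaussianShiftDensity_nonneg (v i) σ) hL]
  refine abs_measureReal_sub_withDensity_le
    (fun x ↦ Finset.prod_nonneg fun i _ ↦ gaussianShiftDensity_nonneg _ _ _)
    (.fintype_prod_dep hL) ?_ ?_ ht ?_ hs
  · simp only [← Finset.prod_pow, gaussianShiftDensity_sq]
    exact .fintype_prod_dep
      (f := fun i x ↦ exp (2 * v i / σ ^ 2 * x - v i ^ 2 / σ ^ 2))
      fun i ↦ integrable_exp_mul_sub_gaussianReal _ _ _
  · rw [integral_fintype_prod_eq_prod]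
    exact Finset.prod_eq_one fun i _ ↦ integral_gaussianShiftDensity hσ _
  · simp only [← Finset.prod_pow]
    rw [integral_fintype_prod_eq_prod (fun i x ↦ gaussianShiftDensity (v i) σ x ^ 2)]
    simp only [integral_gaussianShiftDensity_sq hσ]
    rw [← exp_sum, ← Finset.sum_div, ← EuclideanSpace.real_norm_sq_eq, ← div_pow]
    have hle : (‖v‖ / σ) ^ 2 ≤ 1 := pow_le_one₀ ht.le h1.le
    have := (abs_le.1 (abs_exp_sub_one_sub_id_le (x := (‖v‖ / σ) ^ 2)
      (by rwa [abs_of_nonneg (sq_nonneg _)]))).2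
    nlinarith [sq_nonneg (‖v‖ / σ)]
end
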